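/- Let 𝒞 = (C₁ ← C₂ ← ⋯) be an inverse system of chain complexes of modules which satisfies the Mittag-Leffler condition degreewise. Then for each degree * there is a short exact sequence 0 → lim¹ H^{*-1}(Cₙ) → H^*(lim Cₙ) → lim H^*(Cₙ) → 0. -/

import Mathlib

section InverseSystems

variable {R : Type*} [CommRing R]

/-- The composite transition map `C (n + k) →ₗ C n` of an inverse system of modules with
one-step transition maps `g n : C (n+1) →ₗ C n`. -/
def chainDown {C : ℕ → Type*} [∀ n, AddCommGroup (C n)] [∀ n, Module R (C n)]
    (g : ∀ n, C (n + 1) →ₗ[R] C n) (n : ℕ) : ∀ k : ℕ, C (n + k) →ₗ[R] C n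
  | 0 => LinearMap.id
  | (k + 1) => (chainDown g n k).comp (g (n + k))

/-- The Mittag-Leffler condition for an inverse system of modules indexed by `ℕ`:
for each `n` the decreasing chain of images `Im (C j → C n)` stabilizes. -/
def MittagLeffler {C : ℕ → Type*} [∀ n, AddCommGroup (C n)] [∀ n, Module R (C n)]
    (g : ∀ n, C (n + 1) →ₗ[R] C n) : Prop :=
  ∀ n : ℕ, ∃ i : ℕ, ∀ j : ℕ,
    LinearMap.range (chainDown g n (i + j)) = LinearMap.range (chainDown g n i)

/-- The inverse limit of an inverse system of modules, as a submodule of the product. -/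
def limMod (C : ℕ → Type*) [∀ n, AddCommGroup (C n)] [∀ n, Module R (C n)]
    (g : ∀ n, C (n + 1) →ₗ[R] C n) : Submodule R (∀ n, C n) where
  carrier := {x | ∀ n, g n (x (n + 1)) = x n}
  add_mem' := by intro a b ha hb n; simp only [Pi.add_apply, map_add, ha n, hb n]
  zero_mem' := by intro n; simp
  smul_mem' := by intro c x hx n; simp only [Pi.smul_apply, map_smul, hx n]

/-- The map `∏ Cₙ → ∏ Cₙ`, `(xₙ) ↦ (xₙ - gₙ(x_{n+1}))`, whose kernel is `lim` and whose
cokernel is `lim¹` of the inverse system. -/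
def shiftMap (C : ℕ → Type*) [∀ n, AddCommGroup (C n)] [∀ n, Module R (C n)]
    (g : ∀ n, C (n + 1) →ₗ[R] C n) : (∀ n, C n) →ₗ[R] (∀ n, C n) :=
  LinearMap.pi (fun n => LinearMap.proj n - (g n).comp (LinearMap.proj (n + 1)))

/-- `lim¹` (the first derived functor of the inverse limit) of an `ℕ`-indexed inverse system
of modules, defined as the cokernel of the shift map on the product. -/
abbrev limOne (C : ℕ → Type*) [∀ n, AddCommGroup (C n)] [∀ n, Module R (C n)]
    (g : ∀ n, C (n + 1) →ₗ[R] C n) :=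
  (∀ n, C n) ⧸ LinearMap.range (shiftMap C g)

end InverseSystems
section Homology

variable {R : Type*} [CommRing R]

/-- The homology `ker h ⧸ im f` of a (not necessarily composable-to-zero) pair of linear maps
`f : M →ₗ N`, `h : N →ₗ P`, i.e. the cohomology of a cochain complex at the middle spot. -/
abbrev homol {M N P : Type*} [AddCommGroup M] [AddCommGroup N] [AddCommGroup P]
    [Module R M] [Module R N] [Module R P] (f : M →ₗ[R] N) (h : N →ₗ[R] P) :=
  ↥(LinearMap.ker h) ⧸ (Submodule.comap (LinearMap.ker h).subtype (LinearMap.range f))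

/-- The map induced on homology by a chain map. -/
noncomputable def homolMap {M1 N1 P1 M2 N2 P2 : Type*}
    [AddCommGroup M1] [AddCommGroup N1] [AddCommGroup P1]
    [AddCommGroup M2] [AddCommGroup N2] [AddCommGroup P2]
    [Module R M1] [Module R N1] [Module R P1] [Module R M2] [Module R N2] [Module R P2]
    (f1 : M1 →ₗ[R] N1) (h1 : N1 →ₗ[R] P1) (f2 : M2 →ₗ[R] N2) (h2 : N2 →ₗ[R] P2)
    (φM : M1 →ₗ[R] M2) (φN : N1 →ₗ[R] N2) (φP : P1 →ₗ[R] P2)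
    (c1 : h2.comp φN = φP.comp h1) (c2 : φN.comp f1 = f2.comp φM) :
    homol f1 h1 →ₗ[R] homol f2 h2 :=
  Submodule.mapQ _ _
    (φN.restrict (p := LinearMap.ker h1) (q := LinearMap.ker h2) (by
      intro x hx
      have hx' : h1 x = 0 := hx
      have hc := LinearMap.congr_fun c1 x
      simp only [LinearMap.comp_apply] at hc
      simp only [LinearMap.mem_ker, hc, hx', map_zero]))
    (by
      rintro ⟨x, hxk⟩ hx
      have hx' : x ∈ LinearMap.range f1 := hx
      obtain ⟨a, ha⟩ := hx'
      show _ ∈ LinearMap.range f2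
      refine ⟨φM a, ?_⟩
      have hc := LinearMap.congr_fun c2 a
      simp only [LinearMap.comp_apply] at hc
      show f2 (φM a) = φN x
      rw [← hc, ha])

end Homology
section LimMap

variable {R : Type*} [CommRing R]

/-- The map induced on inverse limits by a levelwise map commuting with the transition maps. -/
def limMap {C C' : ℕ → Type*} [∀ n, AddCommGroup (C n)] [∀ n, Module R (C n)]
    [∀ n, AddCommGroup (C' n)] [∀ n, Module R (C' n)]
    (g : ∀ n, C (n + 1) →ₗ[R] C n) (g' : ∀ n, C' (n + 1) →ₗ[R] C' n)
    (φ : ∀ n, C n →ₗ[R] C' n)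
    (hc : ∀ n, (φ n).comp (g n) = (g' n).comp (φ (n + 1))) :
    ↥(limMod C g) →ₗ[R] ↥(limMod C' g') where
  toFun x := ⟨fun n => φ n (x.1 n), by
    intro n
    have hx : ∀ m, g m (x.1 (m + 1)) = x.1 m := x.2
    have hcn := LinearMap.congr_fun (hc n) (x.1 (n + 1))
    simp only [LinearMap.comp_apply] at hcn
    rw [← hcn, hx n]⟩
  map_add' := by
    intro x y
    apply Subtype.ext
    funext n
    simp
  map_smul' := by
    intro c x
    apply Subtype.ext
    funext n
    simp

end LimMap

section Helpers

variable {R : Type*} [CommRing R]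

/-- Iterated images, defined without casts. -/
def imgSub {C : ℕ → Type*} [∀ n, AddCommGroup (C n)] [∀ n, Module R (C n)]
    (g : ∀ n, C (n + 1) →ₗ[R] C n) : ∀ (k n : ℕ), Submodule R (C n)
  | 0, _ => ⊤
  | (k + 1), n => (imgSub g k (n + 1)).map (g n)

/-- Partial sums of images. -/
def partSum {C : ℕ → Type*} [∀ n, AddCommGroup (C n)] [∀ n, Module R (C n)]
    (g : ∀ n, C (n + 1) →ₗ[R] C n) (a : ∀ n, C n) : ∀ (k n : ℕ), C n
  | 0, _ => 0
  | (k + 1), n => a n + g n (partSum g a k (n + 1))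

theorem map_chainDown {C : ℕ → Type*} [∀ n, AddCommGroup (C n)] [∀ n, Module R (C n)]
    (g : ∀ n, C (n + 1) →ₗ[R] C n) (n k : ℕ) : ∀ j : ℕ,
    (imgSub g j (n + k)).map (chainDown g n k) = imgSub g (k + j) n := by
  induction k with
  | zero => intro j; simp [chainDown]
  | succ k ih =>
    intro j
    have h := ih (j + 1)
    rw [show k + 1 + j = k + (j + 1) by omega, ← h]
    simp only [chainDown, imgSub]
    rw [Submodule.map_comp]
    rfl

theorem range_chainDown {C : ℕ → Type*} [∀ n, AddCommGroup (C n)] [∀ n, Module R (C n)]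
    (g : ∀ n, C (n + 1) →ₗ[R] C n) (n k : ℕ) :
    LinearMap.range (chainDown g n k) = imgSub g k n := by
  have h := map_chainDown g n k 0
  simpa [imgSub] using h

theorem imgSub_anti {C : ℕ → Type*} [∀ n, AddCommGroup (C n)] [∀ n, Module R (C n)]
    (g : ∀ n, C (n + 1) →ₗ[R] C n) (k : ℕ) : ∀ (j n : ℕ),
    imgSub g (k + j) n ≤ imgSub g k n := by
  induction k with
  | zero => intro j n; simp [imgSub]
  | succ k ih =>
    intro j n
    rw [show k + 1 + j = (k + j) + 1 by omega]
    exact Submodule.map_mono (ih j (n + 1))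

theorem partSum_sub {C : ℕ → Type*} [∀ n, AddCommGroup (C n)] [∀ n, Module R (C n)]
    (g : ∀ n, C (n + 1) →ₗ[R] C n) (a : ∀ n, C n) (k : ℕ) : ∀ (j n : ℕ),
    partSum g a (k + j) n - partSum g a k n ∈ imgSub g k n := by
  induction k with
  | zero => intro j n; simp [imgSub]
  | succ k ih =>
    intro j n
    rw [show k + 1 + j = (k + j) + 1 by omega]
    exact ⟨_, ih j (n + 1), by simp [partSum]⟩

theorem ml_surj {C : ℕ → Type*} [∀ n, AddCommGroup (C n)] [∀ n, Module R (C n)]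
    (g : ∀ n, C (n + 1) →ₗ[R] C n) (h : MittagLeffler g) (a : ∀ n, C n) :
    ∃ x : ∀ n, C n, ∀ n, x n - g n (x (n + 1)) = a n := by
  choose i hi using h
  simp only [range_chainDown] at hi
  let M : ℕ → ℕ := fun n => ∑ k ∈ Finset.range (n + 1), i k
  have hM1 : ∀ n, i n ≤ M n := fun n =>
    Finset.single_le_sum (f := i) (fun _ _ => Nat.zero_le _) (Finset.self_mem_range_succ n)
  have hM2 : ∀ n, M n ≤ M (n + 1) := fun n => by
    simp only [M]; rw [Finset.sum_range_succ _ (n + 1)]; omega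
  have hS : ∀ n j, imgSub g (M n) n ≤ imgSub g j n := by
    intro n j
    have e : imgSub g (M n) n = imgSub g (i n) n := by
      have := hi n (M n - i n); rwa [Nat.add_sub_cancel' (hM1 n)] at this
    rw [e, ← hi n j, add_comm]
    exact imgSub_anti g j (i n) n
  have hlift : ∀ n (s : C n), s ∈ imgSub g (M n) n →
      ∃ t : C (n + 1), t ∈ imgSub g (M (n + 1)) (n + 1) ∧ g n t = s := by
    intro n s hs
    obtain ⟨t, ht, e⟩ := hS n (M (n + 1) + 1) hs
    exact ⟨t, ht, e⟩
  let y : ∀ n, C n := fun n => partSum g a (M n) n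
  let b : ∀ n, C n := fun n => a n - (y n - g n (y (n + 1)))
  have hb : ∀ n, b n ∈ imgSub g (M n) n := by
    intro n
    have h1 := partSum_sub g a (M n) (M (n + 1) + 1 - M n) n
    rw [Nat.add_sub_cancel' (by have := hM2 n; omega)] at h1
    have : b n = partSum g a (M (n + 1) + 1) n - partSum g a (M n) n := by
      simp only [b, y, partSum]; abel
    rwa [this]
  choose l hl using hlift
  let z : ∀ n, imgSub g (M n) n := fun n => Nat.rec (motive := fun n => imgSub g (M n) n) 0
    (fun n s => ⟨l n (s.1 - b n) (Submodule.sub_mem _ s.2 (hb n)), (hl n _ _).1⟩) n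
  have hz : ∀ n, g n (z (n + 1)).1 = (z n).1 - b n := fun n =>
    (hl n ((z n).1 - b n) (Submodule.sub_mem _ (z n).2 (hb n))).2
  refine ⟨fun n => y n + (z n).1, fun n => ?_⟩
  simp only [map_add, hz, b]
  abel

theorem exists_factor {X Y Z V : Type*} [AddCommGroup X] [AddCommGroup Y] [AddCommGroup Z]
    [Zero V] [Module R X] [Module R Y] [Module R Z]
    (q : X →ₗ[R] Y) (f : X →ₗ[R] Z) (p : Z → V) (hq : Function.Surjective q)
    (hk : ∀ x, q x = 0 ↔ f x = 0) (hp : ∀ z, p z = 0 ↔ ∃ x, f x = z) :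
    ∃ ι : Y →ₗ[R] Z, Function.Injective ι ∧ Function.Exact ι p := by
  let ι : Y →ₗ[R] Z := ((LinearMap.ker q).liftQ f (fun x hx => (hk x).1 hx)).comp
    (q.quotKerEquivOfSurjective hq).symm.toLinearMap
  have hι : ∀ x, ι (q x) = f x := by
    intro x
    have : (q.quotKerEquivOfSurjective hq).symm (q x) = (LinearMap.ker q).mkQ x := by
      rw [LinearEquiv.symm_apply_eq]; rfl
    simp only [ι, LinearMap.comp_apply, LinearEquiv.coe_coe, this]
    rfl
  refine ⟨ι, ?_, ?_⟩
  · rw [injective_iff_map_eq_zero]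
    intro y hy
    obtain ⟨x, rfl⟩ := hq y
    rw [hι] at hy
    exact (hk x).2 hy
  · intro z
    rw [hp]
    constructor
    · rintro ⟨x, rfl⟩; exact ⟨q x, hι x⟩
    · rintro ⟨y, rfl⟩
      obtain ⟨x, rfl⟩ := hq y
      exact ⟨x, (hι x).symm⟩

theorem homol_mk_eq_zero {M N P : Type*} [AddCommGroup M] [AddCommGroup N] [AddCommGroup P]
    [Module R M] [Module R N] [Module R P] (f : M →ₗ[R] N) (h : N →ₗ[R] P)
    (x : LinearMap.ker h) :
    (Submodule.Quotient.mk x : homol f h) = 0 ↔ ∃ m, f m = x.1 := by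
  rw [Submodule.Quotient.mk_eq_zero]; rfl

/-- The quotient map to homology. -/
def homolMk {M N P : Type*} [AddCommGroup M] [AddCommGroup N] [AddCommGroup P]
    [Module R M] [Module R N] [Module R P] (f : M →ₗ[R] N) (h : N →ₗ[R] P) :
    LinearMap.ker h →ₗ[R] homol f h where
  toFun x := Submodule.Quotient.mk x
  map_add' _ _ := rfl
  map_smul' _ _ := rfl

end Helpers

section Milnor

variable {R : Type*} [CommRing R]

/-- The projection from cycles of the limit to the limit of homologies. -/
noncomputable def milPi0 {A B C : ℕ → Type*}
    [∀ n, AddCommGroup (A n)] [∀ n, Module R (A n)]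
    [∀ n, AddCommGroup (B n)] [∀ n, Module R (B n)]
    [∀ n, AddCommGroup (C n)] [∀ n, Module R (C n)]
    (dA : ∀ n, A n →ₗ[R] B n) (dB : ∀ n, B n →ₗ[R] C n)
    (gA : ∀ n, A (n + 1) →ₗ[R] A n)
    (gB : ∀ n, B (n + 1) →ₗ[R] B n) (gC : ∀ n, C (n + 1) →ₗ[R] C n)
    (cA : ∀ n, (dA n).comp (gA n) = (gB n).comp (dA (n + 1)))
    (cB : ∀ n, (dB n).comp (gB n) = (gC n).comp (dB (n + 1))) :
    LinearMap.ker (limMap gB gC dB cB) →ₗ[R] ↥(limMod (fun n => homol (dA n) (dB n))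
            (fun n => homolMap (dA (n + 1)) (dB (n + 1)) (dA n) (dB n)
              (gA n) (gB n) (gC n) (cB n) (cA n).symm)) where
  toFun := fun b => ⟨fun n => Submodule.Quotient.mk ⟨b.1.1 n, by
          exact congrFun (congrArg Subtype.val b.2) n⟩, by
          intro n
          refine congrArg Submodule.Quotient.mk (Subtype.ext ?_)
          exact b.1.2 n⟩
  map_add' := fun b c => rfl
  map_smul' := fun r b => rfl

theorem milPi0_eq_zero {A B C : ℕ → Type*}
    [∀ n, AddCommGroup (A n)] [∀ n, Module R (A n)]
    [∀ n, AddCommGroup (B n)] [∀ n, Module R (B n)]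
    [∀ n, AddCommGroup (C n)] [∀ n, Module R (C n)]
    (dA : ∀ n, A n →ₗ[R] B n) (dB : ∀ n, B n →ₗ[R] C n)
    (gA : ∀ n, A (n + 1) →ₗ[R] A n)
    (gB : ∀ n, B (n + 1) →ₗ[R] B n) (gC : ∀ n, C (n + 1) →ₗ[R] C n)
    (cA : ∀ n, (dA n).comp (gA n) = (gB n).comp (dA (n + 1)))
    (cB : ∀ n, (dB n).comp (gB n) = (gC n).comp (dB (n + 1)))
    (b : LinearMap.ker (limMap gB gC dB cB)) :
    milPi0 dA dB gA gB gC cA cB b = 0 ↔ ∃ x : ∀ n, A n, ∀ n, dA n (x n) = b.1.1 n := by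
    constructor
    · intro h
      have h' : ∀ n, ∃ x, dA n x = b.1.1 n := fun n =>
        (homol_mk_eq_zero _ _ _).1 (congrFun (congrArg Subtype.val h) n)
      choose x hx using h'
      exact ⟨x, hx⟩
    · rintro ⟨x, hx⟩
      apply Subtype.ext
      funext n
      exact (homol_mk_eq_zero _ _ _).2 ⟨x n, hx n⟩

/-- The projection from homology of the limit to the limit of homologies. -/
noncomputable def milPi {A B C : ℕ → Type*}
    [∀ n, AddCommGroup (A n)] [∀ n, Module R (A n)]
    [∀ n, AddCommGroup (B n)] [∀ n, Module R (B n)]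
    [∀ n, AddCommGroup (C n)] [∀ n, Module R (C n)]
    (dA : ∀ n, A n →ₗ[R] B n) (dB : ∀ n, B n →ₗ[R] C n)
    (gA : ∀ n, A (n + 1) →ₗ[R] A n)
    (gB : ∀ n, B (n + 1) →ₗ[R] B n) (gC : ∀ n, C (n + 1) →ₗ[R] C n)
    (cA : ∀ n, (dA n).comp (gA n) = (gB n).comp (dA (n + 1)))
    (cB : ∀ n, (dB n).comp (gB n) = (gC n).comp (dB (n + 1))) :
    homol (limMap gA gB dA cA) (limMap gB gC dB cB)
          →ₗ[R] ↥(limMod (fun n => homol (dA n) (dB n))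
            (fun n => homolMap (dA (n + 1)) (dB (n + 1)) (dA n) (dB n)
              (gA n) (gB n) (gC n) (cB n) (cA n).symm)) where
  toFun z := ⟨fun n => homolMap (limMap gA gB dA cA) (limMap gB gC dB cB) (dA n) (dB n)
      ((LinearMap.proj n).comp (limMod A gA).subtype)
      ((LinearMap.proj n).comp (limMod B gB).subtype)
      ((LinearMap.proj n).comp (limMod C gC).subtype) rfl rfl z, by
    obtain ⟨b, rfl⟩ := Submodule.Quotient.mk_surjective _ z
    exact (milPi0 dA dB gA gB gC cA cB b).2⟩
  map_add' _ _ := Subtype.ext (funext fun _ => map_add _ _ _)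
  map_smul' _ _ := Subtype.ext (funext fun _ => map_smul _ _ _)

theorem milPi_mk {A B C : ℕ → Type*}
    [∀ n, AddCommGroup (A n)] [∀ n, Module R (A n)]
    [∀ n, AddCommGroup (B n)] [∀ n, Module R (B n)]
    [∀ n, AddCommGroup (C n)] [∀ n, Module R (C n)]
    (dA : ∀ n, A n →ₗ[R] B n) (dB : ∀ n, B n →ₗ[R] C n)
    (gA : ∀ n, A (n + 1) →ₗ[R] A n)
    (gB : ∀ n, B (n + 1) →ₗ[R] B n) (gC : ∀ n, C (n + 1) →ₗ[R] C n)
    (cA : ∀ n, (dA n).comp (gA n) = (gB n).comp (dA (n + 1)))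
    (cB : ∀ n, (dB n).comp (gB n) = (gC n).comp (dB (n + 1)))
    (b : LinearMap.ker (limMap gB gC dB cB)) :
    milPi dA dB gA gB gC cA cB (Submodule.Quotient.mk b) = milPi0 dA dB gA gB gC cA cB b :=
  rfl

end Milnor

set_option maxHeartbeats 400000 in
/-- Milnor exact sequence; Weibel, Prop. 3.5.8.
Let `𝒞 = (C₁ ← C₂ ← ⋯)` be an inverse system of cochain complexes of modules satisfying the
degreewise Mittag-Leffler condition.  Then, at each degree, there is a short exact sequence
`0 → lim¹ H^{*-1}(Cₙ) → H^*(lim Cₙ) → lim H^*(Cₙ) → 0`.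

Here we display a window `W → A → B → C` of four consecutive degrees of the complexes:
the degree-`(*-1)` homology of the `n`-th complex is `homol (dW n) (dA n)`, its degree-`*`
homology is `homol (dA n) (dB n)`, and the degree-`*` homology of the limit complex is
`homol D1 D2` for the induced differentials `D1, D2` on the inverse limits. -/
theorem milnor_exact_sequence
    (R : Type*) [CommRing R]
    (W A B C : ℕ → Type*)
    [∀ n, AddCommGroup (W n)] [∀ n, Module R (W n)]
    [∀ n, AddCommGroup (A n)] [∀ n, Module R (A n)]
    [∀ n, AddCommGroup (B n)] [∀ n, Module R (B n)]
    [∀ n, AddCommGroup (C n)] [∀ n, Module R (C n)]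
    -- the differentials of the `n`-th complex
    (dW : ∀ n, W n →ₗ[R] A n) (dA : ∀ n, A n →ₗ[R] B n) (dB : ∀ n, B n →ₗ[R] C n)
    (hWA : ∀ n, (dA n).comp (dW n) = 0) (hAB : ∀ n, (dB n).comp (dA n) = 0)
    -- the transition chain maps of the inverse system
    (gW : ∀ n, W (n + 1) →ₗ[R] W n) (gA : ∀ n, A (n + 1) →ₗ[R] A n)
    (gB : ∀ n, B (n + 1) →ₗ[R] B n) (gC : ∀ n, C (n + 1) →ₗ[R] C n)
    (cW : ∀ n, (dW n).comp (gW n) = (gA n).comp (dW (n + 1)))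
    (cA : ∀ n, (dA n).comp (gA n) = (gB n).comp (dA (n + 1)))
    (cB : ∀ n, (dB n).comp (gB n) = (gC n).comp (dB (n + 1)))
    -- the degreewise Mittag-Leffler condition
    (mlW : MittagLeffler gW) (mlA : MittagLeffler gA)
    (mlB : MittagLeffler gB) (mlC : MittagLeffler gC) :
    ∃ (ι : limOne (fun n => homol (dW n) (dA n))
            (fun n => homolMap (dW (n + 1)) (dA (n + 1)) (dW n) (dA n)
              (gW n) (gA n) (gB n) (cA n) (cW n).symm)
          →ₗ[R] homol (limMap gA gB dA cA) (limMap gB gC dB cB))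
      (π : homol (limMap gA gB dA cA) (limMap gB gC dB cB)
          →ₗ[R] ↥(limMod (fun n => homol (dA n) (dB n))
            (fun n => homolMap (dA (n + 1)) (dB (n + 1)) (dA n) (dB n)
              (gA n) (gB n) (gC n) (cB n) (cA n).symm))),
      Function.Injective ι ∧ Function.Exact ι π ∧ Function.Surjective π := by
  have eW : ∀ n w, dW n (gW n w) = gA n (dW (n + 1) w) := fun n w => LinearMap.congr_fun (cW n) w
  have eA : ∀ n w, dA n (gA n w) = gB n (dA (n + 1) w) := fun n w => LinearMap.congr_fun (cA n) w
  have eB : ∀ n w, dB n (gB n w) = gC n (dB (n + 1) w) := fun n w => LinearMap.congr_fun (cB n) w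
  have zW : ∀ n w, dA n (dW n w) = 0 := fun n w => LinearMap.congr_fun (hWA n) w
  have zA : ∀ n w, dB n (dA n w) = 0 := fun n w => LinearMap.congr_fun (hAB n) w
  have hπ0 := milPi0_eq_zero dA dB gA gB gC cA cB
  have hπ := milPi_mk dA dB gA gB gC cA cB
  have hsurj : Function.Surjective (milPi dA dB gA gB gC cA cB) := by
    rintro ⟨c, hc⟩
    have : ∀ n, ∃ b : LinearMap.ker (dB n), (Submodule.Quotient.mk b : homol (dA n) (dB n)) = c n :=
      fun n => Submodule.Quotient.mk_surjective _ (c n)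
    choose b hb using this
    have hy : ∀ n, ∃ y, dA n y = (b n).1 - gB n (b (n + 1)).1 := by
      intro n
      have h1 := hc n
      rw [← hb n, ← hb (n + 1)] at h1
      have h2 := (Submodule.Quotient.eq _).1 h1.symm
      exact h2
    choose y hy using hy
    obtain ⟨z, hz⟩ := ml_surj gA mlA y
    have hbk : ∀ n, dB n (b n).1 = 0 := fun n => (b n).2
    refine ⟨Submodule.Quotient.mk ⟨⟨fun n => (b n).1 - dA n (z n), ?_⟩, ?_⟩, ?_⟩
    · intro n
      have h1 := hy n
      rw [← hz n, map_sub, eA] at h1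
      simp only [map_sub]
      rw [sub_eq_sub_iff_add_eq_add] at h1 ⊢
      rw [add_comm, ← h1, add_comm]
    · apply Subtype.ext
      funext n
      show dB n ((b n).1 - dA n (z n)) = 0
      rw [map_sub, zA, hbk, sub_zero]
    · rw [hπ]
      apply Subtype.ext
      funext n
      show _ = c n
      rw [← hb n]
      refine (Submodule.Quotient.eq _).2 ⟨-z n, ?_⟩
      show dA n (-z n) = (b n).1 - dA n (z n) - (b n).1
      rw [map_neg]; abel
  -- the roof for the connecting homomorphism
  let X : Submodule R (∀ n, A n) :=
    { carrier := {x | ∀ n, dA n (x n - gA n (x (n + 1))) = 0}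
      add_mem' := by
        intro x y hx hy n
        have := congrArg₂ (· + ·) (hx n) (hy n)
        simp only [map_sub, Pi.add_apply, map_add, add_zero] at this ⊢
        rw [← this]; abel
      zero_mem' := by intro n; simp
      smul_mem' := by
        intro r x hx n
        have := congrArg (r • ·) (hx n)
        simpa [smul_sub] using this }
  let q0 : X →ₗ[R] (∀ n, homol (dW n) (dA n)) :=
    { toFun := fun x n => Submodule.Quotient.mk ⟨x.1 n - gA n (x.1 (n + 1)), x.2 n⟩
      map_add' := fun x y => by
        funext n
        refine congrArg Submodule.Quotient.mk (Subtype.ext ?_)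
        show (x.1 n + y.1 n) - gA n (x.1 (n + 1) + y.1 (n + 1)) =
          (x.1 n - gA n (x.1 (n + 1))) + (y.1 n - gA n (y.1 (n + 1)))
        rw [map_add]; abel
      map_smul' := fun r x => by
        funext n
        refine congrArg Submodule.Quotient.mk (Subtype.ext ?_)
        show r • x.1 n - gA n (r • x.1 (n + 1)) = r • (x.1 n - gA n (x.1 (n + 1)))
        rw [map_smul, smul_sub] }
  let q := (Submodule.mkQ (LinearMap.range (shiftMap (fun n => homol (dW n) (dA n))
            (fun n => homolMap (dW (n + 1)) (dA (n + 1)) (dW n) (dA n)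
              (gW n) (gA n) (gB n) (cA n) (cW n).symm)))).comp q0
  let f0 : X →ₗ[R] LinearMap.ker (limMap gB gC dB cB) :=
    { toFun := fun x => ⟨⟨fun n => dA n (x.1 n), fun n => by
          have h := x.2 n
          rw [map_sub, eA, sub_eq_zero] at h
          exact h.symm⟩, by
          apply Subtype.ext
          funext n
          exact zA n _⟩
      map_add' := fun x y => by
        apply Subtype.ext
        apply Subtype.ext
        funext n
        exact map_add (dA n) _ _
      map_smul' := fun r x => by
        apply Subtype.ext
        apply Subtype.ext
        funext n
        exact map_smul (dA n) _ _ }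
  let f := (homolMk (limMap gA gB dA cA) (limMap gB gC dB cB)).comp f0
  have hf : ∀ x, f x = 0 ↔ ∃ l : ∀ n, A n, (∀ n, gA n (l (n + 1)) = l n) ∧
      ∀ n, dA n (l n) = dA n (x.1 n) := by
    intro x
    refine (homol_mk_eq_zero (limMap gA gB dA cA) (limMap gB gC dB cB) (f0 x)).trans ?_
    constructor
    · rintro ⟨l, hl⟩
      exact ⟨l.1, l.2, fun n => congrFun (congrArg Subtype.val hl) n⟩
    · rintro ⟨l, h1, h2⟩
      exact ⟨⟨l, h1⟩, Subtype.ext (funext h2)⟩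
  have hq : ∀ x, q x = 0 ↔ ∃ (y : ∀ n, A n) (w : ∀ n, W n), (∀ n, dA n (y n) = 0) ∧
      ∀ n, dW n (w n) = (y n - gA n (y (n + 1))) - (x.1 n - gA n (x.1 (n + 1))) := by
    intro x
    refine (Submodule.Quotient.mk_eq_zero _).trans ?_
    constructor
    · rintro ⟨c, hc⟩
      have : ∀ n, ∃ b : LinearMap.ker (dA n),
          (Submodule.Quotient.mk b : homol (dW n) (dA n)) = c n :=
        fun n => Submodule.Quotient.mk_surjective _ (c n)
      choose b hb using this
      have hw : ∀ n, ∃ w, dW n w = ((b n).1 - gA n (b (n + 1)).1) -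
          (x.1 n - gA n (x.1 (n + 1))) := by
        intro n
        have h1 := congrFun hc n
        simp only [shiftMap, LinearMap.pi_apply, LinearMap.sub_apply, LinearMap.comp_apply,
          LinearMap.proj_apply] at h1
        rw [← hb n, ← hb (n + 1)] at h1
        have h2 := (Submodule.Quotient.eq _).1 h1
        exact h2
      choose w hw using hw
      exact ⟨fun n => (b n).1, w, fun n => (b n).2, hw⟩
    · rintro ⟨y, w, hy, hw⟩
      refine ⟨fun n => Submodule.Quotient.mk ⟨y n, hy n⟩, ?_⟩
      funext n
      exact (Submodule.Quotient.eq _).2 ⟨w n, hw n⟩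
  have hqs : Function.Surjective q := by
    intro c
    obtain ⟨c, rfl⟩ := Submodule.Quotient.mk_surjective _ c
    have : ∀ n, ∃ b : LinearMap.ker (dA n),
        (Submodule.Quotient.mk b : homol (dW n) (dA n)) = c n :=
      fun n => Submodule.Quotient.mk_surjective _ (c n)
    choose b hb using this
    obtain ⟨x, hx⟩ := ml_surj gA mlA (fun n => (b n).1)
    refine ⟨⟨x, fun n => by rw [hx n]; exact (b n).2⟩, ?_⟩
    refine congrArg Submodule.Quotient.mk ?_
    funext n
    rw [← hb n]
    exact congrArg Submodule.Quotient.mk (Subtype.ext (hx n))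
  obtain ⟨ι, h1, h2⟩ := exists_factor q f (milPi dA dB gA gB gC cA cB) hqs (by
      intro x
      rw [hq, hf]
      constructor
      · rintro ⟨y, w, hy, hw⟩
        obtain ⟨v, hv⟩ := ml_surj gW mlW w
        refine ⟨fun n => x.1 n - y n + dW n (v n), fun n => ?_, fun n => ?_⟩
        · have h := hw n
          rw [← hv n, map_sub, eW] at h
          simp only [map_sub, map_add]
          linear_combination (norm := module) (-1 : R) • h
        · rw [map_add, map_sub, hy, zW]; simp
      · rintro ⟨l, hl, hd⟩
        refine ⟨fun n => x.1 n - l n, 0, fun n => ?_, fun n => ?_⟩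
        · rw [map_sub, hd, sub_self]
        · simp only [map_sub, hl, Pi.zero_apply, map_zero]; abel) (by
      intro z
      obtain ⟨b, rfl⟩ := Submodule.Quotient.mk_surjective _ z
      rw [hπ, hπ0]
      constructor
      · rintro ⟨x, hx⟩
        refine ⟨⟨x, fun n => ?_⟩, ?_⟩
        · rw [map_sub, eA, hx, hx, sub_eq_zero]
          exact (b.1.2 n).symm
        · refine congrArg Submodule.Quotient.mk ?_
          apply Subtype.ext
          apply Subtype.ext
          funext n
          exact hx n
      · rintro ⟨x, hx⟩
        obtain ⟨⟨l, hl⟩, e⟩ := (Submodule.Quotient.eq _).1 hx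
        refine ⟨fun n => x.1 n - l n, fun n => ?_⟩
        have e' : dA n (l n) = dA n (x.1 n) - b.1.1 n := congrFun (congrArg Subtype.val e) n
        rw [map_sub, e', sub_sub_cancel])
  exact ⟨ι, _, h1, h2, hsurj⟩
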